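/- For all s, t ∈ ℝ, the probit loss satisfies the quadratic majorization inequality −log Φ(t) ≤ −log Φ(s) − (φ(s)/Φ(s))·(t − s) + (1/2)·(t − s)². -/

import Mathlib

/-- The density `φ` of the standard normal distribution `N(0,1)`. -/
noncomputable def stdGaussPDF (t : ℝ) : ℝ := (Real.sqrt (2 * Real.pi))⁻¹ * Real.exp (-t ^ 2 / 2)

/-- The cumulative distribution function `Φ` of the standard normal distribution `N(0,1)`. -/
noncomputable def stdGaussCDF (t : ℝ) : ℝ := ∫ x in Set.Iic t, stdGaussPDF x

theorem stdGaussPDF_pos (x : ℝ) : 0 < stdGaussPDF x := by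
  unfold stdGaussPDF
  positivity

theorem integrable_stdGaussPDF : MeasureTheory.Integrable stdGaussPDF := by
  have h := (integrable_exp_neg_mul_sq (b := 1 / 2) (by norm_num)).const_mul
    (Real.sqrt (2 * Real.pi))⁻¹
  refine h.congr (.of_forall fun x => ?_)
  simp only [stdGaussPDF]
  ring_nf

theorem integrable_neg_mul_stdGaussPDF :
    MeasureTheory.Integrable fun x => -x * stdGaussPDF x := by
  have h := (integrable_mul_exp_neg_mul_sq (b := 1 / 2) (by norm_num)).const_mul
    (-(Real.sqrt (2 * Real.pi))⁻¹)
  refine h.congr (.of_forall fun x => ?_)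
  simp only [stdGaussPDF]
  ring_nf

theorem hasDerivAt_stdGaussPDF (x : ℝ) : HasDerivAt stdGaussPDF (-x * stdGaussPDF x) x := by
  have h : HasDerivAt (fun y : ℝ => -y ^ 2 / 2) (-x) x :=
    ((hasDerivAt_pow 2 x).fun_neg.div_const 2).congr_deriv (by ring)
  refine (h.exp.const_mul (Real.sqrt (2 * Real.pi))⁻¹).congr_deriv ?_
  rw [stdGaussPDF]
  ring

theorem stdGaussCDF_pos (s : ℝ) : 0 < stdGaussCDF s := by
  refine (MeasureTheory.setIntegral_pos_iff_support_of_nonneg_ae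
    (.of_forall fun x => (stdGaussPDF_pos x).le) integrable_stdGaussPDF.integrableOn).2 ?_
  have h : Function.support stdGaussPDF = Set.univ :=
    Set.eq_univ_of_forall fun x => (stdGaussPDF_pos x).ne'
  simp [h]

theorem setIntegral_Iic_neg_mul_stdGaussPDF (s : ℝ) :
    ∫ x in Set.Iic s, -x * stdGaussPDF x = stdGaussPDF s := by
  have h := MeasureTheory.integral_Iic_of_hasDerivAt_of_tendsto' (a := s)
    (fun x _ => hasDerivAt_stdGaussPDF x) integrable_neg_mul_stdGaussPDF.integrableOn
    (MeasureTheory.tendsto_zero_of_hasDerivAt_of_integrableOn_Iic (a := s)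
      (fun x _ => hasDerivAt_stdGaussPDF x) integrable_neg_mul_stdGaussPDF.integrableOn
      integrable_stdGaussPDF.integrableOn)
  simpa using h

theorem stdGaussCDF_add (s d : ℝ) :
    stdGaussCDF (s + d) = ∫ x in Set.Iic s, stdGaussPDF (x + d) := by
  have h := (MeasureTheory.measurePreserving_add_right MeasureTheory.volume d).setIntegral_preimage_emb
    (measurableEmbedding_addRight d) stdGaussPDF (Set.Iic (s + d))
  simpa [stdGaussCDF] using h.symm

theorem stdGaussPDF_add (x d : ℝ) :
    stdGaussPDF (x + d) = stdGaussPDF x * Real.exp (-x * d - d ^ 2 / 2) := by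
  rw [stdGaussPDF, stdGaussPDF, mul_assoc, ← Real.exp_add]
  ring_nf

/-- Tangent-line form of the convexity of `t ↦ log Φ(t) + t² / 2`, multiplicatively. -/
theorem stdGaussCDF_mul_exp_le (s d : ℝ) :
    stdGaussCDF s * Real.exp (stdGaussPDF s / stdGaussCDF s * d - d ^ 2 / 2) ≤
      stdGaussCDF (s + d) := by
  have hs := (stdGaussCDF_pos s).ne'
  set r := stdGaussPDF s / stdGaussCDF s with hr
  have hI₀ := (integrable_stdGaussPDF.integrableOn (s := Set.Iic s)).const_mul (1 - r * d)
  have hI₁ := (integrable_neg_mul_stdGaussPDF.integrableOn (s := Set.Iic s)).const_mul d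
  have hint : ∫ x in Set.Iic s, ((1 - r * d) * stdGaussPDF x + d * (-x * stdGaussPDF x)) =
      stdGaussCDF s := by
    rw [MeasureTheory.integral_add hI₀ hI₁, MeasureTheory.integral_const_mul,
      MeasureTheory.integral_const_mul, setIntegral_Iic_neg_mul_stdGaussPDF, ← stdGaussCDF, hr]
    field_simp
    ring
  rw [stdGaussCDF_add, mul_comm, ← hint, ← MeasureTheory.integral_const_mul]
  refine MeasureTheory.integral_mono ((hI₀.add hI₁).const_mul _)
    (integrable_stdGaussPDF.comp_add_right d).integrableOn fun x => ?_
  have hexp : Real.exp (-x * d - d ^ 2 / 2) =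
      Real.exp (r * d - d ^ 2 / 2) * Real.exp ((-x - r) * d) := by
    rw [← Real.exp_add]
    ring_nf
  calc Real.exp (r * d - d ^ 2 / 2) * ((1 - r * d) * stdGaussPDF x + d * (-x * stdGaussPDF x))
      = stdGaussPDF x * (Real.exp (r * d - d ^ 2 / 2) * ((-x - r) * d + 1)) := by ring
    _ ≤ stdGaussPDF x * (Real.exp (r * d - d ^ 2 / 2) * Real.exp ((-x - r) * d)) := by
        gcongr
        · exact (stdGaussPDF_pos x).le
        · exact Real.add_one_le_exp _
    _ = stdGaussPDF (x + d) := by rw [stdGaussPDF_add, hexp]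

/-- Quadratic majorization of the probit loss: for all `s, t ∈ ℝ`,
`−log Φ(t) ≤ −log Φ(s) − (φ(s)/Φ(s))·(t − s) + (1/2)·(t − s)²`. -/
theorem probitLoss_quadratic_majorization (s t : ℝ) :
    -Real.log (stdGaussCDF t) ≤
      -Real.log (stdGaussCDF s) - stdGaussPDF s / stdGaussCDF s * (t - s) +
        1 / 2 * (t - s) ^ 2 := by
  have hs := stdGaussCDF_pos s
  have h := Real.log_le_log (by positivity) (stdGaussCDF_mul_exp_le s (t - s))
  rw [Real.log_mul hs.ne' (Real.exp_ne_zero _), Real.log_exp, add_sub_cancel] at h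
  linarith
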